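/- Define g : R^3 -> R by g(x,y,z) = (1/576) * ( 48 x y z - 2 y^3 - 6 y (x + z - y)^2 + max(2y - x - z, 0)^3 + max(z - 3x, 0)^3 + max(x - 3z, 0)^3 - max(x - 2y - 3z, 0)^3 - max(z - 2y - 3x, 0)^3 ), and w : R^3 -> R by w(x,y,z) = x y z (x+y)(y+z)(x+y+z)/12. Then 119750400 times the Lebesgue integral of g * w over the region {(x,y,z) in R^3 : 0 < x, 0 < y, 0 < z, x + 2y + 3z < 20, 3x + 2y + z < 36, x + 2y + z < 20} equals 28744287411306496/2187. -/

import Mathlib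

open MeasureTheory

/-- The asymptotic dimension of `SL₂`-invariants in irreducible `SL₄`-representations
(the paper's Corollary `finalformula`). -/
noncomputable def gInv (p : ℝ × ℝ × ℝ) : ℝ :=
  (1 / 576) *
    (48 * p.1 * p.2.1 * p.2.2 - 2 * p.2.1 ^ 3 -
      6 * p.2.1 * (p.1 + p.2.2 - p.2.1) ^ 2 +
      max (2 * p.2.1 - p.1 - p.2.2) 0 ^ 3 +
      max (p.2.2 - 3 * p.1) 0 ^ 3 + max (p.1 - 3 * p.2.2) 0 ^ 3 -
      max (p.1 - 2 * p.2.1 - 3 * p.2.2) 0 ^ 3 -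
      max (p.2.2 - 2 * p.2.1 - 3 * p.1) 0 ^ 3)

/-- The asymptotic Weyl dimension for `SL₄`. -/
noncomputable def wDim (p : ℝ × ℝ × ℝ) : ℝ :=
  p.1 * p.2.1 * p.2.2 * (p.1 + p.2.1) * (p.2.1 + p.2.2) *
    (p.1 + p.2.1 + p.2.2) / 12

/-- The open standard tetrahedron in `ℝ³`. -/
def openTetrahedron : Set (ℝ × ℝ × ℝ) :=
  {p | 0 < p.1 ∧ 0 < p.2.1 ∧ 0 < p.2.2 ∧ p.1 + p.2.1 + p.2.2 < 1}

theorem measurableSet_openTetrahedron : MeasurableSet openTetrahedron := by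
  unfold openTetrahedron
  apply IsOpen.measurableSet
  simp only [Set.ofPred_and]
  refine ((isOpen_lt ?_ ?_).inter ((isOpen_lt ?_ ?_).inter ((isOpen_lt ?_ ?_).inter
    (isOpen_lt ?_ ?_)))) <;> fun_prop

theorem Continuous.integrableOn_openTetrahedron {f : ℝ × ℝ × ℝ → ℝ} (hf : Continuous f) :
    IntegrableOn f openTetrahedron := by
  refine (hf.continuousOn.integrableOn_compact
    (isCompact_Icc (a := (0, 0, 0)) (b := (1, 1, 1)))).mono_set ?_
  rintro ⟨x, y, z⟩ ⟨hx, hy, hz, h⟩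
  dsimp only at *
  exact ⟨⟨hx.le, hy.le, hz.le⟩, by dsimp; linarith, by dsimp; linarith, by dsimp; linarith⟩

theorem setIntegral_Ioo_pow_mul_sub_pow (b k : ℕ) {m : ℝ} (hm : 0 ≤ m) :
    ∫ t in Set.Ioo 0 m, t ^ b * (m - t) ^ k =
      b.factorial * k.factorial / (b + k + 1).factorial * m ^ (b + k + 1) := by
  rw [← integral_Ioc_eq_integral_Ioo, ← intervalIntegral.integral_of_le hm]
  induction b generalizing k with
  | zero =>
    have h := intervalIntegral.integral_comp_sub_left (a := 0) (b := m) (fun t : ℝ => t ^ k) m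
    simp only [sub_self, sub_zero, integral_pow] at h
    simp only [pow_zero, one_mul, h, zero_add, Nat.factorial_succ, Nat.factorial_zero]
    have := Nat.factorial_ne_zero k
    push_cast
    field_simp
    simp
  | succ b ih =>
    have h := intervalIntegral.integral_eq_sub_of_hasDerivAt (a := 0) (b := m)
      (f := fun t : ℝ => t ^ (b + 1) * (m - t) ^ (k + 1))
      (f' := fun t => (b + 1) * (t ^ b * (m - t) ^ (k + 1)) -
        (k + 1) * (t ^ (b + 1) * (m - t) ^ k))
      (fun t _ => ((hasDerivAt_pow (b + 1) t).mul
        (((hasDerivAt_id' t).const_sub m).pow (k + 1))).congr_deriv (by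
          simp only [Nat.add_sub_cancel, Pi.pow_apply]
          push_cast
          ring))
      (Continuous.intervalIntegrable (by fun_prop) _ _)
    rw [intervalIntegral.integral_sub (Continuous.intervalIntegrable (by fun_prop) _ _)
      (Continuous.intervalIntegrable (by fun_prop) _ _),
      intervalIntegral.integral_const_mul, intervalIntegral.integral_const_mul, ih] at h
    have e : b + 1 + k + 1 = b + (k + 1) + 1 := by ring
    have hk : (k + 1 : ℝ) ≠ 0 := by positivity
    rw [e]
    apply mul_left_cancel₀ hk
    simp only [sub_self, ne_eq, Nat.add_eq_zero_iff, one_ne_zero, and_false, not_false_eq_true,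
      zero_pow, mul_zero, zero_mul, sub_zero, Nat.factorial_succ k, Nat.factorial_succ b] at h ⊢
    push_cast at h ⊢
    linear_combination -h

theorem setIntegral_openTetrahedron {f : ℝ × ℝ × ℝ → ℝ} (hf : Continuous f) :
    ∫ p in openTetrahedron, f p =
      ∫ x in Set.Ioo 0 1, ∫ y in Set.Ioo 0 (1 - x), ∫ z in Set.Ioo 0 (1 - x - y), f (x, y, z) := by
  have hm := measurableSet_openTetrahedron
  have h1 := (integrable_indicator_iff hm).2 hf.integrableOn_openTetrahedron
  rw [← integral_indicator hm, Measure.volume_eq_prod, integral_prod _ h1,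
    ← integral_indicator measurableSet_Ioo]
  congr 1
  funext x
  have h2 : Integrable (fun q : ℝ × ℝ => openTetrahedron.indicator f (x, q))
      (volume.prod volume) := by
    have : (fun q : ℝ × ℝ => openTetrahedron.indicator f (x, q)) =
      (Prod.mk x ⁻¹' openTetrahedron).indicator (fun q => f (x, q)) := rfl
    rw [this, integrable_indicator_iff (measurable_prodMk_left hm), ← Measure.volume_eq_prod]
    refine (Continuous.continuousOn (by fun_prop)).integrableOn_compact
      (isCompact_Icc (a := (0, 0)) (b := (1, 1))) |>.mono_set ?_
    rintro ⟨y, z⟩ ⟨hx, hy, hz, h⟩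
    dsimp only at *
    exact ⟨⟨hy.le, hz.le⟩, by dsimp; linarith, by dsimp; linarith⟩
  rw [Measure.volume_eq_prod, integral_prod _ h2]
  by_cases hx : x ∈ Set.Ioo (0 : ℝ) 1
  · rw [Set.indicator_of_mem hx, ← integral_indicator measurableSet_Ioo]
    congr 1
    funext y
    by_cases hy : y ∈ Set.Ioo 0 (1 - x)
    · rw [Set.indicator_of_mem hy, ← integral_indicator measurableSet_Ioo]
      congr 1
      funext z
      have : (x, y, z) ∈ openTetrahedron ↔ z ∈ Set.Ioo 0 (1 - x - y) :=
        ⟨fun h => ⟨h.2.2.1, by linarith [h.2.2.2]⟩,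
          fun h => ⟨hx.1, hy.1, h.1, by dsimp; linarith [h.2]⟩⟩
      by_cases hz : z ∈ Set.Ioo 0 (1 - x - y)
      · rw [Set.indicator_of_mem hz, Set.indicator_of_mem (this.2 hz)]
      · rw [Set.indicator_of_notMem hz, Set.indicator_of_notMem (mt this.1 hz)]
    · rw [Set.indicator_of_notMem hy]
      refine integral_eq_zero_of_ae (.of_forall fun z => Set.indicator_of_notMem ?_ _)
      rintro ⟨-, h1, h2, h3⟩
      exact hy ⟨h1, by dsimp at *; linarith⟩
  · rw [Set.indicator_of_notMem hx]
    refine integral_eq_zero_of_ae (.of_forall fun y => ?_)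
    refine integral_eq_zero_of_ae (.of_forall fun z => Set.indicator_of_notMem ?_ _)
    rintro ⟨h0, h1, h2, h3⟩
    exact hx ⟨h0, by dsimp at *; linarith⟩

theorem setIntegral_openTetrahedron_monomial (a b c : ℕ) :
    ∫ p in openTetrahedron, p.1 ^ a * p.2.1 ^ b * p.2.2 ^ c =
      a.factorial * b.factorial * c.factorial / (a + b + c + 3).factorial := by
  rw [setIntegral_openTetrahedron (by fun_prop)]
  have h1 : ∀ x y : ℝ, y ∈ Set.Ioo 0 (1 - x) →
      ∫ z in Set.Ioo 0 (1 - x - y), x ^ a * y ^ b * z ^ c =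
        x ^ a / (c + 1) * (y ^ b * (1 - x - y) ^ (c + 1)) := fun x y hy => by
    have h := setIntegral_Ioo_pow_mul_sub_pow c 0 (m := 1 - x - y) (by linarith [hy.2])
    simp only [pow_zero, mul_one, Nat.factorial_zero, add_zero, Nat.factorial_succ] at h
    rw [integral_const_mul, h]
    have := Nat.factorial_ne_zero c
    push_cast
    field_simp
  have h2 : ∀ x : ℝ, x ∈ Set.Ioo 0 1 →
      ∫ y in Set.Ioo 0 (1 - x), ∫ z in Set.Ioo 0 (1 - x - y), x ^ a * y ^ b * z ^ c =
        (b.factorial * (c + 1).factorial / (b + (c + 1) + 1).factorial / (c + 1)) *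
          (x ^ a * (1 - x) ^ (b + (c + 1) + 1)) := fun x hx => by
    rw [setIntegral_congr_fun measurableSet_Ioo (h1 x), integral_const_mul,
      setIntegral_Ioo_pow_mul_sub_pow _ _ (by linarith [hx.2])]
    ring
  rw [setIntegral_congr_fun measurableSet_Ioo h2, integral_const_mul,
    setIntegral_Ioo_pow_mul_sub_pow _ _ zero_le_one, one_pow,
    show a + (b + (c + 1) + 1) + 1 = a + b + c + 3 by ring, Nat.factorial_succ c]
  have := Nat.factorial_ne_zero (b + (c + 1) + 1)
  push_cast
  field_simp

/-- The real functions on `ℝ³` given by polynomials of total degree at most `n`. -/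
def polyDegreeLE (n : ℕ) : Submodule ℝ (ℝ × ℝ × ℝ → ℝ) :=
  Submodule.span ℝ {f | ∃ a b c : ℕ, a + b + c ≤ n ∧ f = fun p => p.1 ^ a * p.2.1 ^ b * p.2.2 ^ c}

theorem polyDegreeLE_mono {m n : ℕ} (h : m ≤ n) : polyDegreeLE m ≤ polyDegreeLE n :=
  Submodule.span_mono fun _ ⟨a, b, c, hd, hf⟩ => ⟨a, b, c, hd.trans h, hf⟩

theorem mul_mem_polyDegreeLE {m n : ℕ} {f g : ℝ × ℝ × ℝ → ℝ} (hf : f ∈ polyDegreeLE m)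
    (hg : g ∈ polyDegreeLE n) : (fun p => f p * g p) ∈ polyDegreeLE (m + n) := by
  have h := Submodule.mul_mem_mul hf hg
  unfold polyDegreeLE at h
  rw [Submodule.span_mul_span] at h
  refine Submodule.span_mono ?_ h
  rintro _ ⟨_, ⟨a, b, c, hd, rfl⟩, _, ⟨a', b', c', hd', rfl⟩, rfl⟩
  refine ⟨a + a', b + b', c + c', by lia, ?_⟩
  funext p
  simp only [Pi.mul_apply]
  ring

theorem const_mem_polyDegreeLE (n : ℕ) (r : ℝ) : (fun _ => r) ∈ polyDegreeLE n := by
  have h : (fun p : ℝ × ℝ × ℝ => p.1 ^ 0 * p.2.1 ^ 0 * p.2.2 ^ 0) ∈ polyDegreeLE n :=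
    Submodule.subset_span ⟨0, 0, 0, by simp, rfl⟩
  convert Submodule.smul_mem _ r h using 1
  funext p
  simp

theorem pow_mem_polyDegreeLE {n : ℕ} {f : ℝ × ℝ × ℝ → ℝ} (hf : f ∈ polyDegreeLE n) (k : ℕ) :
    (fun p => f p ^ k) ∈ polyDegreeLE (n * k) := by
  induction k with
  | zero => simpa using const_mem_polyDegreeLE 0 1
  | succ k ih => simpa only [pow_succ, mul_add_one] using mul_mem_polyDegreeLE ih hf

theorem affine_mem_polyDegreeLE (r a b c : ℝ) :
    (fun p => r + p.1 * a + p.2.1 * b + p.2.2 * c) ∈ polyDegreeLE 1 := by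
  have hx : (fun p : ℝ × ℝ × ℝ => p.1 ^ 1 * p.2.1 ^ 0 * p.2.2 ^ 0) ∈ polyDegreeLE 1 :=
    Submodule.subset_span ⟨1, 0, 0, by simp, rfl⟩
  have hy : (fun p : ℝ × ℝ × ℝ => p.1 ^ 0 * p.2.1 ^ 1 * p.2.2 ^ 0) ∈ polyDegreeLE 1 :=
    Submodule.subset_span ⟨0, 1, 0, by simp, rfl⟩
  have hz : (fun p : ℝ × ℝ × ℝ => p.1 ^ 0 * p.2.1 ^ 0 * p.2.2 ^ 1) ∈ polyDegreeLE 1 :=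
    Submodule.subset_span ⟨0, 0, 1, by simp, rfl⟩
  convert Submodule.add_mem _ (Submodule.add_mem _ (Submodule.add_mem _
    (const_mem_polyDegreeLE 1 r) (Submodule.smul_mem _ a hx)) (Submodule.smul_mem _ b hy))
    (Submodule.smul_mem _ c hz) using 1
  funext p
  simp [mul_comm]

theorem continuous_of_mem_polyDegreeLE {n : ℕ} {f : ℝ × ℝ × ℝ → ℝ} (hf : f ∈ polyDegreeLE n) :
    Continuous f := by
  induction hf using Submodule.span_induction with
  | mem f h =>
    obtain ⟨a, b, c, -, rfl⟩ := h
    fun_prop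
  | zero => exact continuous_const
  | add f g _ _ hf hg => exact hf.add hg
  | smul r f _ hf => exact hf.const_smul r

/-- The affine map sending the vertices of the standard tetrahedron to four given points. -/
def tetrahedronMap {K : Type*} [Field K] (u v w t : K × K × K) (p : K × K × K) : K × K × K :=
  (u.1 + p.1 * (v.1 - u.1) + p.2.1 * (w.1 - u.1) + p.2.2 * (t.1 - u.1),
    u.2.1 + p.1 * (v.2.1 - u.2.1) + p.2.1 * (w.2.1 - u.2.1) + p.2.2 * (t.2.1 - u.2.1),
    u.2.2 + p.1 * (v.2.2 - u.2.2) + p.2.1 * (w.2.2 - u.2.2) + p.2.2 * (t.2.2 - u.2.2))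

theorem comp_tetrahedronMap_mem_polyDegreeLE {n : ℕ} {f : ℝ × ℝ × ℝ → ℝ}
    (hf : f ∈ polyDegreeLE n) (u v w t : ℝ × ℝ × ℝ) :
    (fun p => f (tetrahedronMap u v w t p)) ∈ polyDegreeLE n := by
  induction hf using Submodule.span_induction with
  | mem f h =>
    obtain ⟨a, b, c, hd, rfl⟩ := h
    refine polyDegreeLE_mono (m := 1 * a + 1 * b + 1 * c) (by lia) ?_
    exact mul_mem_polyDegreeLE (mul_mem_polyDegreeLE
      (pow_mem_polyDegreeLE (affine_mem_polyDegreeLE _ _ _ _) a)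
      (pow_mem_polyDegreeLE (affine_mem_polyDegreeLE _ _ _ _) b))
      (pow_mem_polyDegreeLE (affine_mem_polyDegreeLE _ _ _ _) c)
  | zero => exact Submodule.zero_mem _
  | add f g _ _ hf hg => exact Submodule.add_mem _ hf hg
  | smul r f _ hf => exact Submodule.smul_mem _ r hf

/-- Six times the signed volume of the tetrahedron with the given vertices. -/
def tetrahedronDet {K : Type*} [Field K] (u v w t : K × K × K) : K :=
  (v.1 - u.1) * ((w.2.1 - u.2.1) * (t.2.2 - u.2.2) - (t.2.1 - u.2.1) * (w.2.2 - u.2.2)) -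
    (w.1 - u.1) * ((v.2.1 - u.2.1) * (t.2.2 - u.2.2) - (t.2.1 - u.2.1) * (v.2.2 - u.2.2)) +
    (t.1 - u.1) * ((v.2.1 - u.2.1) * (w.2.2 - u.2.2) - (w.2.1 - u.2.1) * (v.2.2 - u.2.2))

theorem setIntegral_comp_tetrahedronMap {u v w t : ℝ × ℝ × ℝ} (hD : tetrahedronDet u v w t ≠ 0)
    {S : Set (ℝ × ℝ × ℝ)} (hS : ∀ p, tetrahedronMap u v w t p ∈ S ↔ p ∈ openTetrahedron)
    (f : ℝ × ℝ × ℝ → ℝ) :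
    ∫ p in S, f p = |tetrahedronDet u v w t| *
      ∫ p in openTetrahedron, f (tetrahedronMap u v w t p) := by
  let e : (ℝ × ℝ × ℝ) ≃ₗ[ℝ] (Fin 3 → ℝ) :=
    { toFun := fun p => ![p.1, p.2.1, p.2.2]
      invFun := fun q => (q 0, q 1, q 2)
      map_add' := fun p q => by ext i; fin_cases i <;> rfl
      map_smul' := fun r p => by ext i; fin_cases i <;> rfl
      left_inv := fun p => rfl
      right_inv := fun q => by ext i; fin_cases i <;> rfl }
  let b := Module.Basis.ofEquivFun e
  let M : Matrix (Fin 3) (Fin 3) ℝ :=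
    !![v.1 - u.1, w.1 - u.1, t.1 - u.1; v.2.1 - u.2.1, w.2.1 - u.2.1, t.2.1 - u.2.1;
      v.2.2 - u.2.2, w.2.2 - u.2.2, t.2.2 - u.2.2]
  let L : (ℝ × ℝ × ℝ) →L[ℝ] (ℝ × ℝ × ℝ) := LinearMap.toContinuousLinearMap (Matrix.toLin b b M)
  have hdet : L.det = tetrahedronDet u v w t := by
    rw [LinearMap.det_toContinuousLinearMap, LinearMap.det_toLin, Matrix.det_fin_three]
    simp only [M, tetrahedronDet, Matrix.of_apply, Matrix.cons_val]
    ring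
  have hL : ∀ p, tetrahedronMap u v w t p = u + L p := fun p => by
    have h : e (L p) = M.mulVec ![p.1, p.2.1, p.2.2] := by
      have := LinearMap.toMatrix_mulVec_repr b b (Matrix.toLin b b M) p
      rw [LinearMap.toMatrix_toLin] at this
      exact this.symm
    have hx : (L p).1 = M.mulVec ![p.1, p.2.1, p.2.2] 0 := congrFun h 0
    have hy : (L p).2.1 = M.mulVec ![p.1, p.2.1, p.2.2] 1 := congrFun h 1
    have hz : (L p).2.2 = M.mulVec ![p.1, p.2.1, p.2.2] 2 := congrFun h 2
    simp only [M, Matrix.mulVec, dotProduct, Fin.sum_univ_three, Matrix.of_apply,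
      Matrix.cons_val] at hx hy hz
    ext <;> simp only [tetrahedronMap, Prod.fst_add, Prod.snd_add, hx, hy, hz] <;> ring
  have hbij : Function.Bijective (tetrahedronMap u v w t) := by
    have h := (L.toContinuousLinearEquivOfDetNeZero (hdet ▸ hD)).bijective
    have : tetrahedronMap u v w t = (Equiv.addLeft u) ∘ L := funext hL
    rw [this]
    exact (Equiv.addLeft u).bijective.comp h
  have himg : S = tetrahedronMap u v w t '' openTetrahedron := by
    ext q
    obtain ⟨p, rfl⟩ := hbij.2 q
    rw [hS, hbij.1.mem_set_image]
  have : (volume : Measure (ℝ × ℝ)).IsAddHaarMeasure :=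
    Measure.prod.instIsAddHaarMeasure (volume : Measure ℝ) (volume : Measure ℝ)
  have : (volume : Measure (ℝ × ℝ × ℝ)).IsAddHaarMeasure :=
    Measure.prod.instIsAddHaarMeasure (volume : Measure ℝ) (volume : Measure (ℝ × ℝ))
  rw [himg, integral_image_eq_integral_abs_det_fderiv_smul volume measurableSet_openTetrahedron
    (f' := fun _ => L) (fun p _ => ?_) hbij.1.injOn, hdet, integral_smul, smul_eq_mul]
  rw [show tetrahedronMap u v w t = fun p => u + L p from funext hL]
  exact (L.hasFDerivAt.const_add u).hasFDerivWithinAt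

/-- The Grundmann–Möller cubature rule of degree nine on the standard tetrahedron. -/
def grundmannMoller {K : Type*} [Field K] (f : K × K × K → K) : K :=
  ∑ i ∈ Finset.range 5,
    (-1) ^ i * (12 - 2 * i : K) ^ 9 / (2 ^ 8 * (i.factorial : K) * ((12 - i).factorial : K)) *
      ∑ b ∈ Finset.range (5 - i), ∑ c ∈ Finset.range (5 - i - b),
        ∑ d ∈ Finset.range (5 - i - b - c),
          f ((2 * b + 1) / (12 - 2 * i), (2 * c + 1) / (12 - 2 * i), (2 * d + 1) / (12 - 2 * i))

theorem grundmannMoller_monomial (k l m : ℕ) :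
    grundmannMoller (fun p : ℚ × ℚ × ℚ => p.1 ^ k * p.2.1 ^ l * p.2.2 ^ m) =
      ∑ i ∈ Finset.range 5,
        (-1) ^ i * (12 - 2 * i : ℚ) ^ 9 / (2 ^ 8 * (i.factorial : ℚ) * ((12 - i).factorial : ℚ)) *
          ((∑ b ∈ Finset.range (5 - i), ∑ c ∈ Finset.range (5 - i - b),
            ∑ d ∈ Finset.range (5 - i - b - c),
              (2 * b + 1) ^ k * (2 * c + 1) ^ l * (2 * d + 1) ^ m : ℕ) /
            (12 - 2 * i : ℚ) ^ (k + l + m)) := by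
  unfold grundmannMoller
  push_cast
  simp only [div_pow, Finset.sum_div, div_mul_div_comm, pow_add]

theorem grundmannMoller_monomial_rat : ∀ k ∈ Finset.range 10, ∀ l ∈ Finset.range (10 - k),
    ∀ m ∈ Finset.range (10 - k - l),
      grundmannMoller (fun p : ℚ × ℚ × ℚ => p.1 ^ k * p.2.1 ^ l * p.2.2 ^ m) =
        k.factorial * l.factorial * m.factorial / (k + l + m + 3).factorial := by
  simp only [grundmannMoller_monomial]
  decide +kernel

theorem ratCast_grundmannMoller {f : ℝ × ℝ × ℝ → ℝ} {g : ℚ × ℚ × ℚ → ℚ}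
    (h : ∀ x y z : ℚ, (g (x, y, z) : ℝ) = f (x, y, z)) :
    ((grundmannMoller g : ℚ) : ℝ) = grundmannMoller f := by
  simp only [grundmannMoller]
  push_cast
  simp only [h]
  push_cast
  rfl

theorem setIntegral_openTetrahedron_eq_grundmannMoller {f : ℝ × ℝ × ℝ → ℝ}
    (hf : f ∈ polyDegreeLE 9) : ∫ p in openTetrahedron, f p = grundmannMoller f := by
  induction hf using Submodule.span_induction with
  | mem f h =>
    obtain ⟨a, b, c, hd, rfl⟩ := h
    rw [setIntegral_openTetrahedron_monomial, ← ratCast_grundmannMoller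
      (g := fun p => p.1 ^ a * p.2.1 ^ b * p.2.2 ^ c) (by intros; push_cast; rfl),
      grundmannMoller_monomial_rat a (by simp; lia) b (by simp; lia) c (by simp; lia)]
    push_cast
    rfl
  | zero => simp [grundmannMoller]
  | add f g hf hg ihf ihg =>
    simp only [Pi.add_apply]
    rw [integral_add (continuous_of_mem_polyDegreeLE hf).integrableOn_openTetrahedron
      (continuous_of_mem_polyDegreeLE hg).integrableOn_openTetrahedron, ihf, ihg]
    simp only [grundmannMoller, Pi.add_apply, Finset.sum_add_distrib, mul_add]
  | smul r f _ hf =>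
    simp only [Pi.smul_apply, smul_eq_mul]
    rw [integral_const_mul, hf]
    simp only [grundmannMoller, Pi.smul_apply, smul_eq_mul, Finset.mul_sum, mul_left_comm]

/-- The coordinatewise embedding of `ℚ³` in `ℝ³`. -/
def castTriple (p : ℚ × ℚ × ℚ) : ℝ × ℝ × ℝ := (p.1, p.2.1, p.2.2)

/-- The value of the cubature rule `grundmannMoller` transported to a rational tetrahedron. -/
def tetrahedronCubature (g : ℚ × ℚ × ℚ → ℚ) (u v w t : ℚ × ℚ × ℚ) : ℚ :=
  |tetrahedronDet u v w t| * grundmannMoller fun p => g (tetrahedronMap u v w t p)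

theorem setIntegral_eq_tetrahedronCubature {f : ℝ × ℝ × ℝ → ℝ} {g : ℚ × ℚ × ℚ → ℚ}
    (hf : f ∈ polyDegreeLE 9) (hg : ∀ p, (g p : ℝ) = f (castTriple p)) (u v w t : ℚ × ℚ × ℚ)
    (hD : tetrahedronDet u v w t ≠ 0) {S : Set (ℝ × ℝ × ℝ)}
    (hS : ∀ p, tetrahedronMap (castTriple u) (castTriple v) (castTriple w) (castTriple t) p ∈ S ↔
      p ∈ openTetrahedron) :
    ∫ p in S, f p = tetrahedronCubature g u v w t := by
  have hdet : ((tetrahedronDet u v w t : ℚ) : ℝ) =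
      tetrahedronDet (castTriple u) (castTriple v) (castTriple w) (castTriple t) := by
    simp only [tetrahedronDet, castTriple]
    push_cast
    rfl
  rw [setIntegral_comp_tetrahedronMap (hdet ▸ Rat.cast_ne_zero.2 hD) hS,
    setIntegral_openTetrahedron_eq_grundmannMoller (comp_tetrahedronMap_mem_polyDegreeLE hf _ _ _ _),
    tetrahedronCubature, Rat.cast_mul, Rat.cast_abs, hdet, ratCast_grundmannMoller]
  intro x y z
  rw [hg]
  congr 1
  simp only [tetrahedronMap, castTriple]
  push_cast
  rfl

/-- The asymptotic Weyl dimension for `SL₄` over an arbitrary field. -/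
def weylPart {K : Type*} [Field K] (p : K × K × K) : K :=
  p.1 * p.2.1 * p.2.2 * (p.1 + p.2.1) * (p.2.1 + p.2.2) * (p.1 + p.2.1 + p.2.2) / 12

/-- The part of the integrand without truncated cubes, multiplied by `576`. -/
def corePart {K : Type*} [Field K] (p : K × K × K) : K :=
  (48 * p.1 * p.2.1 * p.2.2 - 2 * p.2.1 ^ 3 - 6 * p.2.1 * (p.1 + p.2.2 - p.2.1) ^ 2) * weylPart p

/-- The linear form with the given integral coefficients. -/
def linForm {K : Type*} [Field K] (l : ℤ × ℤ × ℤ) (p : K × K × K) : K :=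
  l.1 * p.1 + l.2.1 * p.2.1 + l.2.2 * p.2.2

/-- The cube of a linear form times the asymptotic Weyl dimension. -/
def cubePart {K : Type*} [Field K] (l : ℤ × ℤ × ℤ) (p : K × K × K) : K :=
  linForm l p ^ 3 * weylPart p

theorem ratCast_corePart (p : ℚ × ℚ × ℚ) : ((corePart p : ℚ) : ℝ) = corePart (castTriple p) := by
  simp only [corePart, weylPart, castTriple]
  push_cast
  rfl

theorem ratCast_cubePart (l : ℤ × ℤ × ℤ) (p : ℚ × ℚ × ℚ) :
    ((cubePart l p : ℚ) : ℝ) = cubePart l (castTriple p) := by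
  simp only [cubePart, linForm, weylPart, castTriple]
  push_cast
  rfl

theorem linForm_mem_polyDegreeLE (l : ℤ × ℤ × ℤ) :
    (linForm l : ℝ × ℝ × ℝ → ℝ) ∈ polyDegreeLE 1 := by
  convert affine_mem_polyDegreeLE 0 l.1 l.2.1 l.2.2 using 1
  funext p
  simp only [linForm]
  ring

theorem weylPart_mem_polyDegreeLE : (weylPart : ℝ × ℝ × ℝ → ℝ) ∈ polyDegreeLE 6 := by
  have h := linForm_mem_polyDegreeLE
  have := mul_mem_polyDegreeLE (mul_mem_polyDegreeLE (mul_mem_polyDegreeLE (mul_mem_polyDegreeLE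
    (mul_mem_polyDegreeLE (mul_mem_polyDegreeLE (h (1, 0, 0)) (h (0, 1, 0))) (h (0, 0, 1)))
    (h (1, 1, 0))) (h (0, 1, 1))) (h (1, 1, 1))) (const_mem_polyDegreeLE 0 12⁻¹)
  convert this using 1
  funext p
  simp only [linForm, weylPart]
  push_cast
  ring

theorem cubePart_mem_polyDegreeLE (l : ℤ × ℤ × ℤ) :
    (cubePart l : ℝ × ℝ × ℝ → ℝ) ∈ polyDegreeLE 9 := by
  have h := mul_mem_polyDegreeLE (pow_mem_polyDegreeLE (linForm_mem_polyDegreeLE l) 3)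
    weylPart_mem_polyDegreeLE
  exact h

theorem corePart_mem_polyDegreeLE : (corePart : ℝ × ℝ × ℝ → ℝ) ∈ polyDegreeLE 9 := by
  have h := linForm_mem_polyDegreeLE
  have h1 := mul_mem_polyDegreeLE (const_mem_polyDegreeLE 0 48)
    (mul_mem_polyDegreeLE (mul_mem_polyDegreeLE (h (1, 0, 0)) (h (0, 1, 0))) (h (0, 0, 1)))
  have h2 := mul_mem_polyDegreeLE (const_mem_polyDegreeLE 0 2)
    (pow_mem_polyDegreeLE (h (0, 1, 0)) 3)
  have h3 := mul_mem_polyDegreeLE (const_mem_polyDegreeLE 0 6)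
    (mul_mem_polyDegreeLE (h (0, 1, 0)) (pow_mem_polyDegreeLE (h (1, -1, 1)) 2))
  convert mul_mem_polyDegreeLE (m := 3) (Submodule.sub_mem _ (Submodule.sub_mem _ h1 h2) h3)
    weylPart_mem_polyDegreeLE using 1
  funext p
  simp only [linForm, corePart, Pi.sub_apply]
  push_cast
  ring

theorem continuous_linForm (l : ℤ × ℤ × ℤ) : Continuous (linForm l : ℝ × ℝ × ℝ → ℝ) :=
  continuous_of_mem_polyDegreeLE (linForm_mem_polyDegreeLE l)

theorem Continuous.integrableOn_of_subset_cube {f : ℝ × ℝ × ℝ → ℝ} (hf : Continuous f)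
    {S : Set (ℝ × ℝ × ℝ)} (hS : S ⊆ Set.Icc (0, 0, 0) (20, 20, 20)) : IntegrableOn f S :=
  (hf.continuousOn.integrableOn_compact isCompact_Icc).mono_set hS

theorem setIntegral_posPart_cube (l : ℤ × ℤ × ℤ) (S : Set (ℝ × ℝ × ℝ)) :
    ∫ p in S, max (linForm l p) 0 ^ 3 * weylPart p =
      ∫ p in S ∩ {p | 0 < linForm l p}, cubePart l p := by
  rw [← setIntegral_indicator (isOpen_lt continuous_const (continuous_linForm l)).measurableSet]
  congr 1
  funext p
  by_cases h : 0 < linForm l p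
  · rw [Set.indicator_of_mem (by exact h), max_eq_left h.le, cubePart]
  · rw [Set.indicator_of_notMem (by exact h), max_eq_right (not_lt.1 h)]
    ring

theorem setIntegral_cubePart_inter_pos (l : ℤ × ℤ × ℤ) {S : Set (ℝ × ℝ × ℝ)}
    (hS : S ⊆ Set.Icc (0, 0, 0) (20, 20, 20)) :
    ∫ p in S ∩ {p | 0 < linForm l p}, cubePart l p =
      (∫ p in S, cubePart l p) + ∫ p in S ∩ {p | 0 < linForm (-l) p}, cubePart (-l) p := by
  have hw := continuous_of_mem_polyDegreeLE weylPart_mem_polyDegreeLE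
  have hl := continuous_linForm
  rw [← setIntegral_posPart_cube, ← setIntegral_posPart_cube, ← integral_add
    ((continuous_of_mem_polyDegreeLE (cubePart_mem_polyDegreeLE l)).integrableOn_of_subset_cube hS)
    (Continuous.integrableOn_of_subset_cube (by fun_prop) hS)]
  congr 1
  funext p
  have hneg : linForm (-l) p = -linForm l p := by
    simp only [linForm, Prod.fst_neg, Prod.snd_neg]
    push_cast
    ring
  rw [hneg, cubePart]
  rcases le_total (linForm l p) 0 with h | h
  · rw [max_eq_right h, max_eq_left (neg_nonneg.2 h)]
    ring
  · rw [max_eq_left h, max_eq_right (neg_nonpos.2 h)]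
    ring

theorem continuous_gInv_mul_wDim : Continuous fun p => gInv p * wDim p := by
  unfold gInv wDim
  fun_prop

theorem setIntegral_gInv_mul_wDim {S : Set (ℝ × ℝ × ℝ)}
    (hS : S ⊆ Set.Icc (0, 0, 0) (20, 20, 20)) :
    ∫ p in S, gInv p * wDim p = 1 / 576 * ((∫ p in S, corePart p) +
      (∫ p in S ∩ {p | 0 < linForm (-1, 2, -1) p}, cubePart (-1, 2, -1) p) +
      (∫ p in S ∩ {p | 0 < linForm (-3, 0, 1) p}, cubePart (-3, 0, 1) p) +
      (∫ p in S ∩ {p | 0 < linForm (1, 0, -3) p}, cubePart (1, 0, -3) p) -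
      (∫ p in S ∩ {p | 0 < linForm (1, -2, -3) p}, cubePart (1, -2, -3) p) -
      ∫ p in S ∩ {p | 0 < linForm (-3, -2, 1) p}, cubePart (-3, -2, 1) p) := by
  have hw := continuous_of_mem_polyDegreeLE weylPart_mem_polyDegreeLE
  have hl := continuous_linForm
  have hc := continuous_of_mem_polyDegreeLE corePart_mem_polyDegreeLE
  have h : ∀ p, gInv p * wDim p = 1 / 576 * (corePart p +
      max (linForm (-1, 2, -1) p) 0 ^ 3 * weylPart p +
      max (linForm (-3, 0, 1) p) 0 ^ 3 * weylPart p +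
      max (linForm (1, 0, -3) p) 0 ^ 3 * weylPart p -
      max (linForm (1, -2, -3) p) 0 ^ 3 * weylPart p -
      max (linForm (-3, -2, 1) p) 0 ^ 3 * weylPart p) := fun p => by
    have h1 : linForm (-1, 2, -1) p = 2 * p.2.1 - p.1 - p.2.2 := by
      simp only [linForm]; push_cast; ring
    have h2 : linForm (-3, 0, 1) p = p.2.2 - 3 * p.1 := by
      simp only [linForm]; push_cast; ring
    have h3 : linForm (1, 0, -3) p = p.1 - 3 * p.2.2 := by
      simp only [linForm]; push_cast; ring
    have h4 : linForm (1, -2, -3) p = p.1 - 2 * p.2.1 - 3 * p.2.2 := by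
      simp only [linForm]; push_cast; ring
    have h5 : linForm (-3, -2, 1) p = p.2.2 - 2 * p.2.1 - 3 * p.1 := by
      simp only [linForm]; push_cast; ring
    rw [h1, h2, h3, h4, h5]
    simp only [gInv, wDim, corePart, weylPart]
    ring
  simp only [← setIntegral_posPart_cube, h]
  rw [integral_const_mul, integral_sub, integral_sub, integral_add, integral_add, integral_add]
  all_goals exact Continuous.integrableOn_of_subset_cube (by fun_prop) hS

/-- The tetrahedron with vertices `0`, `(20, 0, 0)`, `(0, 10, 0)` and `(0, 0, 20/3)`. -/
def bigTetrahedron : Set (ℝ × ℝ × ℝ) :=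
  {p | 0 < p.1 ∧ 0 < p.2.1 ∧ 0 < p.2.2 ∧ p.1 + 2 * p.2.1 + 3 * p.2.2 < 20}

/-- The tetrahedron with vertices `(8, 6, 0)`, `(12, 0, 0)`, `(20, 0, 0)` and `(11, 0, 3)`. -/
def cutTetrahedron : Set (ℝ × ℝ × ℝ) :=
  {p | 0 < p.2.1 ∧ 0 < p.2.2 ∧ p.1 + 2 * p.2.1 + 3 * p.2.2 < 20 ∧
    36 < 3 * p.1 + 2 * p.2.1 + p.2.2}

theorem bigTetrahedron_subset : bigTetrahedron ⊆ Set.Icc (0, 0, 0) (20, 20, 20) := by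
  rintro ⟨x, y, z⟩ ⟨hx, hy, hz, h⟩
  dsimp only at *
  exact ⟨⟨hx.le, hy.le, hz.le⟩, by dsimp; linarith, by dsimp; linarith, by dsimp; linarith⟩

theorem cutTetrahedron_subset : cutTetrahedron ⊆ bigTetrahedron := by
  rintro ⟨x, y, z⟩ ⟨hy, hz, h, h'⟩
  dsimp only at *
  exact ⟨by dsimp; linarith, hy, hz, h⟩

theorem setIntegral_polytope_eq_sub {f : ℝ × ℝ × ℝ → ℝ} (hf : Continuous f) :
    ∫ p in {p : ℝ × ℝ × ℝ | 0 < p.1 ∧ 0 < p.2.1 ∧ 0 < p.2.2 ∧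
        p.1 + 2 * p.2.1 + 3 * p.2.2 < 20 ∧ 3 * p.1 + 2 * p.2.1 + p.2.2 < 36 ∧
        p.1 + 2 * p.2.1 + p.2.2 < 20}, f p =
      (∫ p in bigTetrahedron, f p) - ∫ p in cutTetrahedron, f p := by
  have hplane : volume {p : ℝ × ℝ × ℝ | 3 * p.1 + 2 * p.2.1 + p.2.2 = 36} = 0 := by
    rw [Measure.volume_eq_prod, Measure.measure_prod_null
      (isClosed_eq (by fun_prop) (by fun_prop)).measurableSet]
    refine .of_forall fun x => ?_
    simp only [Measure.volume_eq_prod, Pi.zero_apply]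
    rw [Measure.measure_prod_null
      ((isClosed_eq (by fun_prop) (by fun_prop)).measurableSet.preimage (by fun_prop))]
    refine .of_forall fun y => ?_
    refine measure_mono_null (t := {36 - 3 * x - 2 * y}) (fun z hz => ?_) (by simp)
    simp only [Set.mem_preimage, Set.mem_ofPred_eq] at hz
    simp only [Set.mem_singleton_iff]
    linarith
  have hcut : cutTetrahedron =ᵐ[volume]
      (bigTetrahedron ∩ {p | 36 ≤ 3 * p.1 + 2 * p.2.1 + p.2.2} : Set (ℝ × ℝ × ℝ)) := by
    have : ∀ᵐ p : ℝ × ℝ × ℝ, 3 * p.1 + 2 * p.2.1 + p.2.2 ≠ 36 := by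
      rw [ae_iff]
      simpa using hplane
    filter_upwards [this] with p hp
    refine propext ⟨fun h => ⟨cutTetrahedron_subset h, h.2.2.2.le⟩, fun h => ?_⟩
    exact ⟨h.1.2.1, h.1.2.2.1, h.1.2.2.2, lt_of_le_of_ne h.2 hp.symm⟩
  have hm : MeasurableSet {p : ℝ × ℝ × ℝ | 36 ≤ 3 * p.1 + 2 * p.2.1 + p.2.2} :=
    (isClosed_le (by fun_prop) (by fun_prop)).measurableSet
  rw [setIntegral_congr_set hcut, eq_sub_iff_add_eq, add_comm, ← integral_inter_add_sdiff hm
    (hf.integrableOn_of_subset_cube bigTetrahedron_subset)]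
  congr 3
  ext ⟨x, y, z⟩
  simp only [bigTetrahedron, Set.mem_ofPred_eq, Set.mem_sdiff, not_le]
  constructor
  · rintro ⟨h1, h2, h3, h4, h5, -⟩
    exact ⟨⟨h1, h2, h3, h4⟩, h5⟩
  · rintro ⟨⟨h1, h2, h3, h4⟩, h5⟩
    exact ⟨h1, h2, h3, h4, h5, by linarith⟩

theorem setIntegral_bigTetrahedron :
    ∫ p in bigTetrahedron, gInv p * wDim p = ((1 / 576 *
      (tetrahedronCubature corePart (0, 0, 0) (20, 0, 0) (0, 10, 0) (0, 0, 20 / 3) +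
      tetrahedronCubature (cubePart (-1, 2, -1)) (0, 0, 0) (0, 10, 0) (10, 5, 0) (0, 5 / 2, 5) +
      tetrahedronCubature (cubePart (-3, 0, 1)) (0, 0, 0) (0, 10, 0) (0, 0, 20 / 3) (2, 0, 6) +
      tetrahedronCubature (cubePart (1, 0, -3)) (0, 0, 0) (20, 0, 0) (0, 10, 0) (10, 0, 10 / 3) -
      tetrahedronCubature (cubePart (1, -2, -3)) (0, 0, 0) (20, 0, 0) (10, 5, 0) (10, 0, 10 / 3) -
      tetrahedronCubature (cubePart (-3, -2, 1)) (0, 0, 0) (0, 0, 20 / 3) (0, 5 / 2, 5)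
        (2, 0, 6)) : ℚ) : ℝ) := by
  have hcube := fun l => setIntegral_eq_tetrahedronCubature (cubePart_mem_polyDegreeLE l)
    (ratCast_cubePart l)
  rw [setIntegral_gInv_mul_wDim bigTetrahedron_subset,
    setIntegral_eq_tetrahedronCubature corePart_mem_polyDegreeLE ratCast_corePart
      (0, 0, 0) (20, 0, 0) (0, 10, 0) (0, 0, 20 / 3),
    hcube _ (0, 0, 0) (0, 10, 0) (10, 5, 0) (0, 5 / 2, 5),
    hcube _ (0, 0, 0) (0, 10, 0) (0, 0, 20 / 3) (2, 0, 6),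
    hcube _ (0, 0, 0) (20, 0, 0) (0, 10, 0) (10, 0, 10 / 3),
    hcube _ (0, 0, 0) (20, 0, 0) (10, 5, 0) (10, 0, 10 / 3),
    hcube _ (0, 0, 0) (0, 0, 20 / 3) (0, 5 / 2, 5) (2, 0, 6)]
  · push_cast
    rfl
  all_goals first
    | norm_num [tetrahedronDet]; done
    | rintro ⟨x, y, z⟩
      simp only [tetrahedronMap, castTriple, bigTetrahedron, openTetrahedron, linForm,
        Set.mem_inter_iff, Set.mem_ofPred_eq, and_assoc]
      push_cast
      refine ⟨fun h => ?_, fun h => ?_⟩ <;> and_intros <;> linarith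

theorem setIntegral_cutTetrahedron :
    ∫ p in cutTetrahedron, gInv p * wDim p = ((1 / 576 *
      (tetrahedronCubature corePart (8, 6, 0) (12, 0, 0) (20, 0, 0) (11, 0, 3) +
      tetrahedronCubature (cubePart (-1, 2, -1)) (8, 6, 0) (9, 9 / 2, 0) (10, 5, 0)
        (26 / 3, 14 / 3, 2 / 3) +
      tetrahedronCubature (cubePart (1, 0, -3)) (8, 6, 0) (12, 0, 0) (20, 0, 0) (11, 0, 3) -
      tetrahedronCubature (cubePart (1, -2, -3)) (8, 6, 0) (12, 0, 0) (20, 0, 0) (11, 0, 3) -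
      tetrahedronCubature (cubePart (-1, 2, 3)) (8, 6, 0) (9, 9 / 2, 0) (10, 5, 0)
        (10, 2, 2)) : ℚ) : ℝ) := by
  have hcube := fun l => setIntegral_eq_tetrahedronCubature (cubePart_mem_polyDegreeLE l)
    (ratCast_cubePart l)
  have hsub := cutTetrahedron_subset.trans bigTetrahedron_subset
  have h2 : cutTetrahedron ∩ {p | 0 < linForm (-3, 0, 1) p} = ∅ := by
    refine Set.eq_empty_of_forall_notMem fun p ⟨⟨h1, h2, h3, h4⟩, h5⟩ => ?_
    simp only [linForm, Set.mem_ofPred_eq] at h5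
    push_cast at h5
    linarith
  have h3 : cutTetrahedron ∩ {p | 0 < linForm (1, 0, -3) p} = cutTetrahedron := by
    refine Set.inter_eq_left.2 fun p ⟨h1, h2, h3, h4⟩ => ?_
    simp only [linForm, Set.mem_ofPred_eq]
    push_cast
    linarith
  have h5 : cutTetrahedron ∩ {p | 0 < linForm (-3, -2, 1) p} = ∅ := by
    refine Set.eq_empty_of_forall_notMem fun p ⟨⟨h1, h2, h3, h4⟩, h5⟩ => ?_
    simp only [linForm, Set.mem_ofPred_eq] at h5
    push_cast at h5
    linarith
  rw [setIntegral_gInv_mul_wDim hsub, setIntegral_cubePart_inter_pos (1, -2, -3) hsub, h2, h3, h5,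
    show -((1, -2, -3) : ℤ × ℤ × ℤ) = (-1, 2, 3) from rfl, setIntegral_empty, setIntegral_empty,
    setIntegral_eq_tetrahedronCubature corePart_mem_polyDegreeLE ratCast_corePart
      (8, 6, 0) (12, 0, 0) (20, 0, 0) (11, 0, 3),
    hcube (-1, 2, -1) (8, 6, 0) (9, 9 / 2, 0) (10, 5, 0) (26 / 3, 14 / 3, 2 / 3),
    hcube (1, 0, -3) (8, 6, 0) (12, 0, 0) (20, 0, 0) (11, 0, 3),
    hcube (1, -2, -3) (8, 6, 0) (12, 0, 0) (20, 0, 0) (11, 0, 3),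
    hcube (-1, 2, 3) (8, 6, 0) (9, 9 / 2, 0) (10, 5, 0) (10, 2, 2)]
  · push_cast
    ring
  all_goals first
    | norm_num [tetrahedronDet]; done
    | rintro ⟨x, y, z⟩
      simp only [tetrahedronMap, castTriple, cutTetrahedron, openTetrahedron, linForm,
        Set.mem_inter_iff, Set.mem_ofPred_eq, and_assoc]
      push_cast
      refine ⟨fun h => ?_, fun h => ?_⟩ <;> and_intros <;> linarith

/-- `12!/4` times the integral of `g · w` over the polytope attached to
the weight `λ = 8ω₁ + 6ω₂` equals `28744287411306496/2187`. -/
theorem stmt_10 :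
    119750400 * ∫ p in {p : ℝ × ℝ × ℝ | 0 < p.1 ∧ 0 < p.2.1 ∧ 0 < p.2.2 ∧
        p.1 + 2 * p.2.1 + 3 * p.2.2 < 20 ∧ 3 * p.1 + 2 * p.2.1 + p.2.2 < 36 ∧
        p.1 + 2 * p.2.1 + p.2.2 < 20},
      gInv p * wDim p = 28744287411306496 / 2187 := by
  rw [setIntegral_polytope_eq_sub continuous_gInv_mul_wDim, setIntegral_bigTetrahedron,
    setIntegral_cutTetrahedron, ← Rat.cast_sub, mul_comm, ← eq_div_iff (by norm_num)]
  have h : (28744287411306496 / 2187 / 119750400 : ℝ) =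
      ((28744287411306496 / 2187 / 119750400 : ℚ) : ℝ) := by
    push_cast
    rfl
  rw [h, Rat.cast_inj]
  decide +kernel
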